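/- Let g be a non-negative monotone submodular set function on a finite set U with g(∅) = 0, d a metric distance on U, D the sum-sum diversity of d, f = g + D, k ≥ 10 and m ≥ 1. Let (T¹,…,Tᵐ) be a uniformly random m-partition of U, let ALG be the greedy algorithm with a consistent tiebreaking rule (so that ALG(T) = ALG(T ∖ {t}) for every t ∈ T ∖ ALG(T)), and set Sⁱ = ALG(Tⁱ). Let O = {o_1,…,o_k} be a k-subset of U maximizing f over k-subsets of U, with prefix sets O_x, and let OPT(∪_i Sⁱ) be a k-subset of ∪_{i=1}^m Sⁱ maximizing f. Then E[Σ_{i=1}^m Σ_{x ∈ O∩Tⁱ∖Sⁱ} (Δ(x,O_x) − Δ(x, O_x ∪ Sⁱ))] ≤ E[f(OPT(∪_{i=1}^m Sⁱ))], where the expectation is over the random partition. -/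

import Mathlib

open Finset

/-- Sum-sum diversity: the sum of `d u v` over all unordered pairs of distinct
elements of `S` (each unordered pair counted once). -/
noncomputable def sumsumDiv {α : Type*} [DecidableEq α] (d : α → α → ℝ) (S : Finset α) : ℝ :=
  (∑ p ∈ S.offDiag, d p.1 p.2) / 2

/-- The marginal gain used by the greedy algorithm:
`gain g d S u = Δ(u, S) + ∑_{x ∈ S} d x u`. -/
noncomputable def gain {α : Type*} [DecidableEq α] (g : Finset α → ℝ) (d : α → α → ℝ)
    (S : Finset α) (u : α) : ℝ :=
  (g (insert u S) - g S) + ∑ x ∈ S, d x u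

open scoped Classical in
/-- Pick, among the elements of `C`, the one maximizing `h` with ties broken by a fixed
a-priori linear ordering (the earliest maximizer); returns it as a singleton set,
or `∅` if `C = ∅`. -/
noncomputable def pick {α : Type*} [LinearOrder α] (h : α → ℝ) (C : Finset α) : Finset α :=
  if hne : (C.filter fun u => ∀ v ∈ C, h v ≤ h u).Nonempty then
    {(C.filter fun u => ∀ v ∈ C, h v ≤ h u).min' hne}
  else ∅

open scoped Classical in
/-- `greedy g d n T` is the set selected after `n` steps of Algorithm 1 (Greedy) on the
ground set `T`: at each step it adds the element of `T` maximizing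
`Δ(u, S) + ∑_{x ∈ S} d x u`, with ties broken consistently by a fixed a-priori ordering. -/
noncomputable def greedy {α : Type*} [LinearOrder α] (g : Finset α → ℝ) (d : α → α → ℝ) :
    ℕ → Finset α → Finset α
  | 0, _ => ∅
  | n + 1, T =>
      let S := greedy g d n T
      S ∪ pick (gain g d S) (T \ S)

/-- Part `i` of the partition of the finite ground set induced by the assignment `π`. -/
def part {α : Type*} [Fintype α] {m : ℕ} (π : α → Fin m) (i : Fin m) : Finset α :=
  Finset.univ.filter fun a => π a = i

/-- Expectation of `F` over a uniformly random `m`-partition of the finite ground set,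
i.e. over a uniformly random assignment `π` of each element independently and uniformly
to one of the `m` parts. -/
noncomputable def expVal {α : Type*} [Fintype α] [DecidableEq α] (m : ℕ)
    (F : (α → Fin m) → ℝ) : ℝ :=
  (∑ π : α → Fin m, F π) / (m : ℝ) ^ (Fintype.card α)

/-- The prefix set `{o 0, …, o (j-1)}` of a sequence `o`. -/
def preSet {α : Type*} [DecidableEq α] {k : ℕ} (o : Fin k → α) (j : ℕ) : Finset α :=
  (Finset.univ.filter fun i : Fin k => (i : ℕ) < j).image o

theorem pick_eq_singleton {α : Type*} [LinearOrder α] {h : α → ℝ} {C : Finset α} {p : α}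
    (hp : p ∈ C) (hmax : ∀ v ∈ C, h v ≤ h p)
    (hmin : ∀ u ∈ C, (∀ v ∈ C, h v ≤ h u) → p ≤ u) : pick h C = {p} := by
  classical
  have hne : (C.filter fun u => ∀ v ∈ C, h v ≤ h u).Nonempty :=
    ⟨p, mem_filter.2 ⟨hp, hmax⟩⟩
  unfold pick
  rw [dif_pos (by convert hne)]
  congr 1
  refine le_antisymm (min'_le _ _ (mem_filter.2 ⟨hp, hmax⟩)) (le_min' _ _ _ fun u hu => ?_)
  exact hmin u (mem_filter.1 hu).1 (mem_filter.1 hu).2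

theorem exists_pick_eq_singleton {α : Type*} [LinearOrder α] (h : α → ℝ) {C : Finset α}
    (hC : C.Nonempty) :
    ∃ p ∈ C, (∀ v ∈ C, h v ≤ h p) ∧ (∀ u ∈ C, (∀ v ∈ C, h v ≤ h u) → p ≤ u) ∧
      pick h C = {p} := by
  classical
  obtain ⟨q, hq, hqmax⟩ := C.exists_max_image h hC
  have hne : (C.filter fun u => ∀ v ∈ C, h v ≤ h u).Nonempty :=
    ⟨q, mem_filter.2 ⟨hq, hqmax⟩⟩
  obtain ⟨hp, hmax⟩ := mem_filter.1 (min'_mem _ hne)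
  have hmin : ∀ u ∈ C, (∀ v ∈ C, h v ≤ h u) → min' _ hne ≤ u :=
    fun u hu hu' => min'_le _ _ (mem_filter.2 ⟨hu, hu'⟩)
  exact ⟨_, hp, hmax, hmin, pick_eq_singleton hp hmax hmin⟩

theorem card_pick_le_one {α : Type*} [LinearOrder α] (h : α → ℝ) (C : Finset α) :
    (pick h C).card ≤ 1 := by
  unfold pick
  split_ifs <;> simp

/-- Deleting an element that is not picked does not change the pick. -/
theorem pick_congr_of_notMem {α : Type*} [LinearOrder α] {h : α → ℝ} {C C' : Finset α} {x : α}
    (hsub : C' ⊆ C) (hC : ∀ y ∈ C, y ≠ x → y ∈ C') (hx : x ∉ pick h C) :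
    pick h C' = pick h C := by
  rcases C.eq_empty_or_nonempty with rfl | hne
  · rw [subset_empty.1 hsub]
  obtain ⟨p, hp, hmax, hmin, heq⟩ := exists_pick_eq_singleton h hne
  have hpx : p ≠ x := by
    rintro rfl
    simp [heq] at hx
  rw [heq]
  refine pick_eq_singleton (hC p hp hpx) (fun v hv => hmax v (hsub hv)) fun u hu hu' => ?_
  exact hmin u (hsub hu) fun v hv => (hmax v hv).trans (hu' p (hC p hp hpx))

theorem card_greedy_le {α : Type*} [LinearOrder α] (g : Finset α → ℝ) (d : α → α → ℝ)
    (n : ℕ) (T : Finset α) : (greedy g d n T).card ≤ n := by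
  induction n with
  | zero => simp [greedy]
  | succ n ih =>
    rw [greedy]
    refine (card_union_le _ _).trans ?_
    exact Nat.add_le_add ih (card_pick_le_one _ _)

/-- Consistency of the greedy algorithm: deleting an unselected element does not change the
output. -/
theorem greedy_congr_of_notMem {α : Type*} [LinearOrder α] (g : Finset α → ℝ)
    (d : α → α → ℝ) {n : ℕ} {T T' : Finset α} {x : α} (hsub : T' ⊆ T)
    (hT : ∀ y ∈ T, y ≠ x → y ∈ T') (hx : x ∉ greedy g d n T) :
    greedy g d n T' = greedy g d n T := by
  induction n with
  | zero => rfl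
  | succ n ih =>
    rw [greedy, mem_union, not_or] at hx
    rw [greedy, greedy, ih hx.1]
    refine congrArg _ (pick_congr_of_notMem (x := x) (sdiff_subset_sdiff hsub subset_rfl)
      (fun y hy hyx => ?_) hx.2)
    rw [mem_sdiff] at hy ⊢
    exact ⟨hT y hy.1 hyx, hy.2⟩

theorem sumsumDiv_nonneg {α : Type*} [DecidableEq α] {d : α → α → ℝ}
    (hd : ∀ u v, 0 ≤ d u v) (S : Finset α) : 0 ≤ sumsumDiv d S :=
  div_nonneg (sum_nonneg fun _ _ => hd _ _) zero_le_two

theorem preSet_succ {α : Type*} [DecidableEq α] {k : ℕ} (o : Fin k → α) (j : Fin k) :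
    preSet o ((j : ℕ) + 1) = insert (o j) (preSet o j) := by
  unfold preSet
  rw [← image_insert]
  congr 1
  ext i
  simp [le_iff_eq_or_lt, Fin.ext_iff]

theorem sum_marginal_preSet_union {α : Type*} [DecidableEq α] {k : ℕ} (g : Finset α → ℝ)
    (o : Fin k → α) (S : Finset α) :
    ∑ j : Fin k, (g (insert (o j) (preSet o j ∪ S)) - g (preSet o j ∪ S))
      = g (preSet o k ∪ S) - g S := by
  have h : ∀ j : Fin k, g (insert (o j) (preSet o j ∪ S)) - g (preSet o j ∪ S)
      = g (preSet o ((j : ℕ) + 1) ∪ S) - g (preSet o j ∪ S) := fun j => by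
    rw [preSet_succ, insert_union]
  rw [sum_congr rfl fun j _ => h j,
    Fin.sum_univ_eq_sum_range (fun j => g (preSet o (j + 1) ∪ S) - g (preSet o j ∪ S)),
    sum_range_sub (fun j => g (preSet o j ∪ S))]
  simp [preSet]

/-- The total loss of marginal gains of the sequence `o` caused by adding `S` is at most
`g S`. -/
theorem sum_marginal_loss_le {α : Type*} [DecidableEq α] {k : ℕ} {g : Finset α → ℝ}
    (hgmono : ∀ A B : Finset α, A ⊆ B → g A ≤ g B) (hg0 : g ∅ = 0)
    (o : Fin k → α) (S : Finset α) :
    ∑ j : Fin k, ((g (insert (o j) (preSet o j)) - g (preSet o j))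
      - (g (insert (o j) (preSet o j ∪ S)) - g (preSet o j ∪ S))) ≤ g S := by
  have h := sum_marginal_preSet_union g o ∅
  simp only [union_empty] at h
  rw [sum_sub_distrib, sum_marginal_preSet_union g o S, h, hg0]
  linarith [hgmono _ _ (subset_union_left : preSet o k ⊆ preSet o k ∪ S)]

theorem marginal_loss_nonneg {α : Type*} [DecidableEq α] {g : Finset α → ℝ}
    (hgmono : ∀ A B : Finset α, A ⊆ B → g A ≤ g B)
    (hgsub : ∀ A B : Finset α, A ⊆ B → ∀ y ∉ B,
      g (insert y B) - g B ≤ g (insert y A) - g A)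
    (y : α) (A S : Finset α) :
    0 ≤ (g (insert y A) - g A) - (g (insert y (A ∪ S)) - g (A ∪ S)) := by
  by_cases hy : y ∈ A ∪ S
  · rw [insert_eq_of_mem hy]
    linarith [hgmono _ _ (subset_insert y A)]
  · linarith [hgsub A (A ∪ S) subset_union_left y hy]

theorem mem_part {α : Type*} [Fintype α] {m : ℕ} {π : α → Fin m} {i : Fin m} {y : α} :
    y ∈ part π i ↔ π y = i := by
  simp [part]

/-- Exchange the names of the part of `x` and part `i₀` for all elements other than `x`. -/
def swapParts {α : Type*} [DecidableEq α] {m : ℕ} (x : α) (i₀ : Fin m) (π : α → Fin m) :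
    α → Fin m :=
  fun y => if y = x then π x else Equiv.swap i₀ (π x) (π y)

theorem swapParts_involutive {α : Type*} [DecidableEq α] {m : ℕ} (x : α) (i₀ : Fin m) :
    Function.Involutive (swapParts x i₀) := by
  intro π
  ext y
  by_cases hy : y = x <;> simp [swapParts, hy]

theorem greedy_part_swapParts {α : Type*} [Fintype α] [DecidableEq α] [LinearOrder α]
    (g : Finset α → ℝ) (d : α → α → ℝ) (k : ℕ) {m : ℕ} {x : α} (i₀ : Fin m)
    {π : α → Fin m} (hx : x ∉ greedy g d k (part π (π x))) :
    greedy g d k (part (swapParts x i₀ π) i₀) = greedy g d k (part π (π x)) := by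
  refine greedy_congr_of_notMem (x := x) g d (fun y hy => ?_) (fun y hy hyx => ?_) hx
  · by_cases hyx : y = x
    · simp [mem_part, hyx]
    · simpa [mem_part, swapParts, hyx, Equiv.swap_apply_eq_iff] using hy
  · simpa [mem_part, swapParts, hyx, Equiv.swap_apply_eq_iff] using hy

/-- The contribution of `x` when it is rejected by its own part is, on average over the
partition, at most its contribution with respect to a fixed part. -/
theorem sum_rejected_le {α : Type*} [Fintype α] [DecidableEq α] [LinearOrder α]
    (g : Finset α → ℝ) (d : α → α → ℝ) (k : ℕ) {m : ℕ} (x : α) (i₀ : Fin m)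
    {G : Finset α → ℝ} (hG : ∀ S, 0 ≤ G S) :
    ∑ π : α → Fin m, ∑ i : Fin m,
        (if x ∈ part π i ∧ x ∉ greedy g d k (part π i) then G (greedy g d k (part π i)) else 0)
      ≤ ∑ π : α → Fin m, G (greedy g d k (part π i₀)) := by
  rw [← Equiv.sum_comp (swapParts_involutive x i₀).toPerm
    (fun π => G (greedy g d k (part π i₀)))]
  refine sum_le_sum fun π _ => ?_
  rw [sum_eq_single (π x)]
  · split_ifs with h
    · simp [greedy_part_swapParts g d k i₀ h.2]
    · exact hG _
  · intro i _ hi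
    rw [if_neg]
    simp [mem_part, hi.symm]
  · simp

/-- Lemma 6: with `(T¹, …, Tᵐ)` a uniformly random `m`-partition of the
finite ground set, `Sⁱ = greedy(Tⁱ)` the output of Algorithm 1 (with its consistent
tiebreaking) on each part, `O = {o 1, …, o k}` a `k`-subset maximizing `f = g + D` with
prefix sets `O_x`, and `OPT(∪ᵢ Sⁱ)` a `k`-subset of `∪ᵢ Sⁱ` maximizing `f` there,
`E[∑ᵢ ∑_{x ∈ O ∩ Tⁱ ∖ Sⁱ} (Δ(x, O_x) − Δ(x, O_x ∪ Sⁱ))] ≤ E[f(OPT(∪ᵢ Sⁱ))]`. -/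
theorem stmt14 {α : Type*} [Fintype α] [DecidableEq α] [LinearOrder α]
    (g : Finset α → ℝ)
    (hgnn : ∀ S : Finset α, 0 ≤ g S)
    (hgmono : ∀ A B : Finset α, A ⊆ B → g A ≤ g B)
    (hgsub : ∀ A B : Finset α, A ⊆ B → ∀ y ∉ B,
      g (insert y B) - g B ≤ g (insert y A) - g A)
    (hg0 : g ∅ = 0)
    (d : α → α → ℝ)
    (hd0 : ∀ u, d u u = 0) (hdnn : ∀ u v, 0 ≤ d u v)
    (hdsymm : ∀ u v, d u v = d v u)
    (hdtri : ∀ u v w, d u w ≤ d u v + d v w)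
    (k m : ℕ) (hk : 10 ≤ k) (hm : 1 ≤ m)
    (o : Fin k → α) (ho : Function.Injective o)
    (hOmax : ∀ R : Finset α, R.card = k →
      g R + sumsumDiv d R
        ≤ g (Finset.univ.image o) + sumsumDiv d (Finset.univ.image o))
    (OPT : (α → Fin m) → Finset α)
    (hOPT : ∀ π : α → Fin m,
      OPT π ⊆ Finset.univ.biUnion (fun i => greedy g d k (part π i)) ∧
      (OPT π).card = k ∧
      ∀ R ⊆ Finset.univ.biUnion (fun i => greedy g d k (part π i)), R.card = k →
        g R + sumsumDiv d R ≤ g (OPT π) + sumsumDiv d (OPT π)) :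
    expVal m (fun π => ∑ i : Fin m,
        ∑ j ∈ Finset.univ.filter (fun j : Fin k =>
            o j ∈ part π i ∧ o j ∉ greedy g d k (part π i)),
          ((g (insert (o j) (preSet o (j : ℕ))) - g (preSet o (j : ℕ)))
            - (g (insert (o j) (preSet o (j : ℕ) ∪ greedy g d k (part π i)))
                - g (preSet o (j : ℕ) ∪ greedy g d k (part π i)))))
      ≤ expVal m (fun π => g (OPT π) + sumsumDiv d (OPT π)) := by
  obtain ⟨i₀⟩ : Nonempty (Fin m) := ⟨⟨0, hm⟩⟩
  refine div_le_div_of_nonneg_right ?_ (by positivity)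
  have hloss : ∀ (j : Fin k) (S : Finset α), 0 ≤ (g (insert (o j) (preSet o (j : ℕ)))
      - g (preSet o (j : ℕ))) - (g (insert (o j) (preSet o (j : ℕ) ∪ S))
      - g (preSet o (j : ℕ) ∪ S)) :=
    fun j S => marginal_loss_nonneg hgmono hgsub _ _ S
  have hopt : ∀ π : α → Fin m,
      g (greedy g d k (part π i₀)) ≤ g (OPT π) + sumsumDiv d (OPT π) := by
    intro π
    obtain ⟨hsub, hcard, hmax⟩ := hOPT π
    obtain ⟨R, hSR, hRU, hR⟩ := exists_subsuperset_card_eq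
      (subset_biUnion_of_mem (fun i => greedy g d k (part π i)) (mem_univ i₀))
      (card_greedy_le g d k (part π i₀)) (hcard.ge.trans (card_le_card hsub))
    linarith [hmax R hRU hR, hgmono _ _ hSR, sumsumDiv_nonneg hdnn R]
  simp only [sum_filter]
  calc
    _ = ∑ j : Fin k, ∑ π : α → Fin m, ∑ i : Fin m, _ :=
      (sum_congr rfl fun π _ => sum_comm).trans sum_comm
    _ ≤ ∑ j : Fin k, ∑ π : α → Fin m, _ :=
      sum_le_sum fun j _ => sum_rejected_le g d k (o j) i₀ (hloss j)
    _ = ∑ π : α → Fin m, ∑ j : Fin k, _ := sum_comm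
    _ ≤ ∑ π : α → Fin m, g (greedy g d k (part π i₀)) :=
      sum_le_sum fun π _ => sum_marginal_loss_le hgmono hg0 o _
    _ ≤ _ := sum_le_sum fun π _ => hopt π
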